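/- Let W_A ≠ W_B be two β-CC winning size-k committees of an election E such that every voter's highest-ranked member of W_A coincides with that voter's highest-ranked member of W_B, and let R be the set of all candidates that are ranked first by at least one voter. Then |R| < k, and the β-CC winning size-k committees of E are exactly the size-k subsets of C that contain R. -/

import Mathlib

/-- An election with `m` candidates and `n` voters: each voter has a strict linear order on
the candidates, represented by the permutation sending each candidate to its position
(`0`-indexed, so the top-ranked candidate has position `0`). -/
structure Election (m n : ℕ) where
  pref : Fin n → (Fin m ≃ Fin m)

/-- The Chamberlin–Courant (β-CC) score of a committee `S`:
`∑_v max_{c ∈ S} (m − pos_v(c))` with `1`-indexed positions. -/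
def ccScore {m n : ℕ} (E : Election m n) (S : Finset (Fin m)) : ℕ :=
  ∑ v : Fin n, S.sup (fun c => m - 1 - (E.pref v c).val)

/-- A size-`k` committee is β-CC winning if no size-`k` committee has strictly greater
β-CC score. -/
def CCWinning {m n : ℕ} (E : Election m n) (k : ℕ) (S : Finset (Fin m)) : Prop :=
  S.card = k ∧ ∀ T : Finset (Fin m), T.card = k → ccScore E T ≤ ccScore E S

/-- `c` is voter `v`'s representative under committee `S`: the highest-ranked
(smallest-position) member of `S` in `v`'s order. -/
def IsRep {m n : ℕ} (E : Election m n) (v : Fin n) (S : Finset (Fin m)) (c : Fin m) : Prop :=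
  c ∈ S ∧ ∀ c' ∈ S, E.pref v c ≤ E.pref v c'

/-- The set of candidates ranked first by at least one voter. -/
def topCands {m n : ℕ} (E : Election m n) : Finset (Fin m) :=
  Finset.univ.filter (fun c : Fin m => ∃ v : Fin n, (E.pref v c).val = 0)

theorem sup_score_le {m n : ℕ} (E : Election m n) (v : Fin n) (S : Finset (Fin m)) :
    S.sup (fun c => m - 1 - (E.pref v c).val) ≤ m - 1 :=
  Finset.sup_le fun _ _ => Nat.sub_le _ _

theorem sup_score_eq_of_top_mem {m n : ℕ} (E : Election m n) {v : Fin n} {S : Finset (Fin m)}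
    {t : Fin m} (ht : (E.pref v t).val = 0) (hS : t ∈ S) :
    S.sup (fun c => m - 1 - (E.pref v c).val) = m - 1 := by
  refine le_antisymm (sup_score_le E v S) ?_
  have h := Finset.le_sup (f := fun c => m - 1 - (E.pref v c).val) hS
  simpa [ht] using h

theorem sup_score_lt_of_top_notMem {m n : ℕ} (E : Election m n) {v : Fin n}
    {S : Finset (Fin m)} {t : Fin m} (hm : 1 < m) (ht : (E.pref v t).val = 0) (hS : t ∉ S) :
    S.sup (fun c => m - 1 - (E.pref v c).val) < m - 1 := by
  rw [Finset.sup_lt_iff (by rw [bot_eq_zero]; omega)]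
  intro c hc
  have hpos : (E.pref v c).val ≠ 0 := fun h => by
    have hct : c = t := (E.pref v).injective (Fin.ext (h.trans ht.symm))
    exact hS (hct ▸ hc)
  omega

theorem exists_isRep {m n : ℕ} (E : Election m n) (v : Fin n) {S : Finset (Fin m)}
    (hS : S.Nonempty) : ∃ c, IsRep E v S c :=
  S.exists_min_image (E.pref v) hS

theorem IsRep.sup_score_le {m n : ℕ} {E : Election m n} {v : Fin n} {S T : Finset (Fin m)}
    {c : Fin m} (hc : IsRep E v S c) (hT : c ∈ T) :
    S.sup (fun c => m - 1 - (E.pref v c).val) ≤ T.sup (fun c => m - 1 - (E.pref v c).val) :=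
  Finset.sup_le fun c' hc' =>
    (Nat.sub_le_sub_left (hc.2 c' hc') _).trans
      (Finset.le_sup (f := fun c => m - 1 - (E.pref v c).val) hT)

theorem ccScore_le {m n : ℕ} (E : Election m n) (S : Finset (Fin m)) :
    ccScore E S ≤ ∑ _v : Fin n, (m - 1) :=
  Finset.sum_le_sum fun v _ => sup_score_le E v S

theorem ccScore_eq_iff {m n : ℕ} (E : Election m n) (hm : 1 < m) (S : Finset (Fin m)) :
    ccScore E S = ∑ _v : Fin n, (m - 1) ↔ topCands E ⊆ S := by
  constructor
  · intro h t ht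
    obtain ⟨v, hv⟩ := (Finset.mem_filter.1 ht).2
    by_contra hS
    exact (Finset.sum_lt_sum (fun v _ => sup_score_le E v S)
      ⟨v, Finset.mem_univ v, sup_score_lt_of_top_notMem E hm hv hS⟩).ne h
  · intro h
    refine Finset.sum_congr rfl fun v _ => ?_
    have ht : (E.pref v ((E.pref v).symm ⟨0, by omega⟩)).val = 0 := by simp
    exact sup_score_eq_of_top_mem E ht (h (Finset.mem_filter.2 ⟨Finset.mem_univ _, v, ht⟩))

/-- A winning committee with a member representing nobody contains every top-ranked candidate:
otherwise exchanging that member for a missing one would raise the score. -/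
theorem CCWinning.topCands_subset {m n k : ℕ} {E : Election m n} {W : Finset (Fin m)}
    (hm : 1 < m) (hW : CCWinning E k W) {x : Fin m} (hx : x ∈ W)
    (hrep : ∀ v, ¬ IsRep E v W x) : topCands E ⊆ W := by
  intro t ht
  obtain ⟨v, hv⟩ := (Finset.mem_filter.1 ht).2
  by_contra htW
  have hcard : (insert t (W.erase x)).card = k := by
    rw [Finset.card_insert_of_notMem fun h => htW (Finset.mem_of_mem_erase h),
      Finset.card_erase_add_one hx, hW.1]
  refine (hW.2 _ hcard).not_gt (Finset.sum_lt_sum (fun w _ => ?_) ⟨v, Finset.mem_univ v, ?_⟩)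
  · obtain ⟨c, hc⟩ := exists_isRep E w ⟨x, hx⟩
    have hcx : c ≠ x := fun h => hrep w (h ▸ hc)
    exact hc.sup_score_le (Finset.mem_insert_of_mem (Finset.mem_erase.2 ⟨hcx, hc.1⟩))
  · rw [sup_score_eq_of_top_mem E hv (Finset.mem_insert_self t _)]
    exact sup_score_lt_of_top_notMem E hm hv htW

theorem statement16 {m n k : ℕ} (E : Election m n) (WA WB : Finset (Fin m))
    (hA : CCWinning E k WA) (hB : CCWinning E k WB) (hne : WA ≠ WB)
    (hsame : ∀ v : Fin n, ∀ cA cB : Fin m,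
      IsRep E v WA cA → IsRep E v WB cB → cA = cB) :
    (topCands E).card < k ∧
    ∀ S : Finset (Fin m), CCWinning E k S ↔ (S.card = k ∧ topCands E ⊆ S) := by
  have hcard : WA.card = WB.card := hA.1.trans hB.1.symm
  obtain ⟨x, hxA, hxB⟩ : ∃ x ∈ WA, x ∉ WB :=
    Finset.not_subset.1 fun h => hne (Finset.eq_of_subset_of_card_le h hcard.ge)
  obtain ⟨y, hyB⟩ : WB.Nonempty :=
    Finset.card_pos.1 (hcard ▸ Finset.card_pos.2 ⟨x, hxA⟩)
  have hm : 1 < m := by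
    have hxy : x.val ≠ y.val := fun h => hxB (Fin.ext h ▸ hyB)
    omega
  have hrep : ∀ v, ¬ IsRep E v WA x := fun v hv => by
    obtain ⟨c, hc⟩ := exists_isRep E v ⟨y, hyB⟩
    exact hxB (hsame v x c hv hc ▸ hc.1)
  have hsub : topCands E ⊆ WA := hA.topCands_subset hm hxA hrep
  have hscore := (ccScore_eq_iff E hm WA).2 hsub
  refine ⟨?_, fun S => ⟨fun hS => ⟨hS.1, ?_⟩, fun hS => ⟨hS.1, fun T _ => ?_⟩⟩⟩
  · rw [← hA.1]
    refine Finset.card_lt_card (Finset.ssubset_iff_of_subset hsub |>.2 ⟨x, hxA, fun hx => ?_⟩)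
    obtain ⟨v, hv⟩ := (Finset.mem_filter.1 hx).2
    exact hrep v ⟨hxA, fun c _ => Fin.le_def.2 (hv ▸ Nat.zero_le _)⟩
  · exact (ccScore_eq_iff E hm S).1 ((ccScore_le E S).antisymm (hscore ▸ hS.2 WA hA.1))
  · exact (ccScore_le E T).trans ((ccScore_eq_iff E hm S).2 hS.2).ge
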